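/- Let (u_k) be iterates of u_{k+1} = u_k − F'(u_k)*(F(u_k) − y) − λ_k·Â'(u_k)*(Â(u_k) − y) with exact data y = F(u†), and set e_k = u_k − u†. Suppose for every k: u_k ∈ B_ρ(u†), ‖Â'(u_k)‖ ≤ L_Â, ‖Â(u_k) − y‖ ≤ C_Â^0, λ_k ≤ C_λ^0·‖F(u_k) − y‖², and that the two-point tangential cone condition ‖F(u) − F(v) − F'(u)(u − v)‖ ≤ ν‖F(u) − F(v)‖ holds for all u, v ∈ B_ρ(u†). Let h ≤ j be indices with ‖F(u_h) − y‖ ≤ ‖F(u_i) − y‖ for all h ≤ i ≤ j. Then |⟨e_h − e_j, e_h⟩| ≤ (1 + 3ν + L_Â·C_Â^0·C_λ^0·ρ)·Σ_{i=h}^{j−1} ‖y − F(u_i)‖². -/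

import Mathlib

open scoped RealInnerProductSpace

/-- Estimate (2.19) in the Cauchy-sequence argument: with `e_k = u_k − u†` and exact data
`y = F(u†)`, under the two-point tangential cone condition and the stated bounds, if `h ≤ j`
and `‖F(u_h) − y‖ ≤ ‖F(u_i) − y‖` for all `h ≤ i ≤ j`, then
`|⟨e_h − e_j, e_h⟩| ≤ (1 + 3ν + L_Â·C_Â⁰·C_λ⁰·ρ)·Σ_{i=h}^{j−1} ‖y − F(u_i)‖²`. -/
theorem stmt8
    {X Y : Type*}
    [NormedAddCommGroup X] [InnerProductSpace ℝ X] [CompleteSpace X]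
    [NormedAddCommGroup Y] [InnerProductSpace ℝ Y] [CompleteSpace Y]
    (F A : X → Y) (udag : X) (y : Y) (ρ ν LA CA Clam : ℝ)
    (u : ℕ → X) (lam : ℕ → ℝ)
    (F' A' : X → X →L[ℝ] Y)
    (hy : y = F udag) (hρ : 0 < ρ) (hν : 0 < ν)
    (hCA : 0 < CA) (hClam : 0 < Clam)
    (hiter : ∀ k : ℕ,
      u (k + 1) = u k - ContinuousLinearMap.adjoint (F' (u k)) (F (u k) - y)
        - lam k • ContinuousLinearMap.adjoint (A' (u k)) (A (u k) - y))
    (hball : ∀ k, u k ∈ Metric.closedBall udag ρ)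
    (hdF : ∀ k, HasFDerivAt F (F' (u k)) (u k))
    (hdA : ∀ k, HasFDerivAt A (A' (u k)) (u k))
    (hLA : ∀ k, ‖A' (u k)‖ ≤ LA)
    (hAres : ∀ k, ‖A (u k) - y‖ ≤ CA)
    (hlam0 : ∀ k, 0 ≤ lam k)
    (hlam2 : ∀ k, lam k ≤ Clam * ‖F (u k) - y‖ ^ 2)
    (htcc : ∀ v ∈ Metric.closedBall udag ρ, ∀ w ∈ Metric.closedBall udag ρ,
      ‖F v - F w - (F' v) (v - w)‖ ≤ ν * ‖F v - F w‖)
    (h j : ℕ) (hhj : h ≤ j)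
    (hmin : ∀ i, h ≤ i → i ≤ j → ‖F (u h) - y‖ ≤ ‖F (u i) - y‖) :
    |⟪(u h - udag) - (u j - udag), u h - udag⟫|
      ≤ (1 + 3 * ν + LA * CA * Clam * ρ) * ∑ i ∈ Finset.Ico h j, ‖y - F (u i)‖ ^ 2 := by
  have hud : udag ∈ Metric.closedBall udag ρ := Metric.mem_closedBall_self hρ.le
  have hLA0 : 0 ≤ LA := (norm_nonneg _).trans (hLA 0)
  have heh : ‖u h - udag‖ ≤ ρ := by
    have := hball h
    rwa [Metric.mem_closedBall, dist_eq_norm] at this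
  have hstep : ∀ i ∈ Finset.Ico h j, |⟪u i - u (i + 1), u h - udag⟫|
      ≤ (1 + 3 * ν + LA * CA * Clam * ρ) * ‖y - F (u i)‖ ^ 2 := by
    intro i hi
    rw [Finset.mem_Ico] at hi
    have hm := hmin i hi.1 hi.2.le
    have e1 : u i - u (i + 1) = ContinuousLinearMap.adjoint (F' (u i)) (F (u i) - y)
        + lam i • ContinuousLinearMap.adjoint (A' (u i)) (A (u i) - y) := by
      rw [hiter i]; abel
    have h1 := htcc (u i) (hball i) udag hud
    have h2 := htcc (u i) (hball i) (u h) (hball h)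
    rw [← hy] at h1
    have e2 : F' (u i) (u h - udag) = (F (u h) - y) - (F (u i) - y - F' (u i) (u i - udag))
        + (F (u i) - F (u h) - F' (u i) (u i - u h)) := by
      simp only [map_sub]; abel
    have h3 : ‖F (u i) - F (u h)‖ ≤ 2 * ‖F (u i) - y‖ := by
      have e : F (u i) - F (u h) = (F (u i) - y) - (F (u h) - y) := by abel
      have := norm_sub_le (F (u i) - y) (F (u h) - y)
      rw [e]; linarith
    have h4 : ‖F' (u i) (u h - udag)‖ ≤ (1 + 3 * ν) * ‖F (u i) - y‖ := by
      rw [e2]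
      have a1 := norm_add_le ((F (u h) - y) - (F (u i) - y - F' (u i) (u i - udag)))
        (F (u i) - F (u h) - F' (u i) (u i - u h))
      have a2 := norm_sub_le (F (u h) - y) (F (u i) - y - F' (u i) (u i - udag))
      have a3 := mul_le_mul_of_nonneg_left h3 hν.le
      linarith
    have h5 : ‖A' (u i) (u h - udag)‖ ≤ LA * ρ :=
      ((A' (u i)).le_opNorm _).trans (mul_le_mul (hLA i) heh (norm_nonneg _) hLA0)
    rw [e1, inner_add_left, real_inner_smul_left, ContinuousLinearMap.adjoint_inner_left,
      ContinuousLinearMap.adjoint_inner_left, norm_sub_rev y]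
    have b1 : |⟪F (u i) - y, F' (u i) (u h - udag)⟫| ≤ (1 + 3 * ν) * ‖F (u i) - y‖ ^ 2 := by
      refine (abs_real_inner_le_norm _ _).trans ?_
      have := mul_le_mul_of_nonneg_left h4 (norm_nonneg (F (u i) - y))
      linarith
    have b2 : |⟪A (u i) - y, A' (u i) (u h - udag)⟫| ≤ CA * (LA * ρ) :=
      (abs_real_inner_le_norm _ _).trans
        (mul_le_mul (hAres i) h5 (norm_nonneg _) hCA.le)
    have b3 : |lam i * ⟪A (u i) - y, A' (u i) (u h - udag)⟫|
        ≤ (Clam * ‖F (u i) - y‖ ^ 2) * (CA * (LA * ρ)) := by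
      rw [abs_mul, abs_of_nonneg (hlam0 i)]
      exact mul_le_mul (hlam2 i) b2 (abs_nonneg _) ((hlam0 i).trans (hlam2 i))
    refine (abs_add_le _ _).trans ((add_le_add b1 b3).trans (le_of_eq ?_))
    ring
  have htel : (u h - udag) - (u j - udag) = ∑ i ∈ Finset.Ico h j, (u i - u (i + 1)) := by
    have e := Finset.sum_Ico_sub u hhj
    have e' : ∑ i ∈ Finset.Ico h j, (u i - u (i + 1))
        = -∑ i ∈ Finset.Ico h j, (u (i + 1) - u i) := by
      rw [← Finset.sum_neg_distrib]
      exact Finset.sum_congr rfl fun i _ => by abel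
    rw [e', e]; abel
  rw [htel, sum_inner, Finset.mul_sum]
  exact (Finset.abs_sum_le_sum_abs _ _).trans (Finset.sum_le_sum hstep)
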